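/- Let K be an algebraically closed field and Λ = K[x_1,…,x_n]. Then the full subcategory H^n_Λ of modules M with pd_Λ M = n, finitely generated projective resolution, and Ext^i_Λ(M,Λ)=0 for i ≠ n, is exactly the full subcategory of Λ-modules of finite length. -/

import Mathlib

open CategoryTheory

noncomputable section

set_option synthInstance.maxHeartbeats 400000
set_option maxHeartbeats 1000000
attribute [local instance] HasDerivedCategory.standard
attribute [local instance] CategoryTheory.hasExt_of_hasDerivedCategory

/-- `M` admits a projective resolution all of whose terms are finitely generated. -/
def HasFGProjRes (Λ : Type) [Ring Λ] (M : ModuleCat.{0} Λ) : Prop :=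
  ∃ P : CategoryTheory.ProjectiveResolution M, ∀ i : ℕ, Module.Finite Λ (P.complex.X i)

/-- Membership in the subcategory `H^n_Λ` of `Mod Λ`: `M` has projective dimension exactly
`n` (expressed via vanishing of `Ext^i(M,-)` for `i > n` and non-vanishing of some
`Ext^n(M,N)`), admits a projective resolution by finitely generated modules, and
`Ext^i_Λ(M,Λ) = 0` for all `i ≠ n`. -/
structure MemH (Λ : Type) [Ring Λ] (n : ℕ) (M : ModuleCat.{0} Λ) : Prop where
  pd_le : ∀ (N : ModuleCat.{0} Λ) (i : ℕ), n < i → Subsingleton (Abelian.Ext M N i)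
  pd_ge : ∃ N : ModuleCat.{0} Λ, Nontrivial (Abelian.Ext M N n)
  fg_res : HasFGProjRes Λ M
  gorenstein : ∀ i : ℕ, i ≠ n → Subsingleton (Abelian.Ext M (ModuleCat.of Λ Λ) i)

/-- The ring `Λ` has (left) global dimension exactly `n`. -/
def GlobalDimEq (Λ : Type) [Ring Λ] (n : ℕ) : Prop :=
  (∀ (M N : ModuleCat.{0} Λ) (i : ℕ), n < i → Subsingleton (Abelian.Ext M N i)) ∧
    ∃ M N : ModuleCat.{0} Λ, Nontrivial (Abelian.Ext M N n)

namespace FGRes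
open Limits
set_option linter.unusedSectionVars false
variable {R : Type} [CommRing R] [IsNoetherianRing R]

lemma exists_cover (M : ModuleCat.{0} R) : ∃ (P : ModuleCat.{0} R) (p : P ⟶ M),
    Projective P ∧ Epi p ∧ (Module.Finite R M → Module.Finite R P) := by
  by_cases h : Module.Finite R M
  · obtain ⟨P, _, _, _, _, f, hf⟩ := Module.exists_finite_presentation R M
    refine ⟨ModuleCat.of R P, ModuleCat.ofHom f, ?_, ?_, fun _ => ‹_›⟩
    · infer_instance
    · rw [ModuleCat.epi_iff_surjective]; exact hf
  · exact ⟨Projective.over M, Projective.π M, inferInstance, inferInstance, fun h' => (h h').elim⟩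

lemma exists_d {X₀ X₁ : ModuleCat.{0} R} (f : X₁ ⟶ X₀) :
    ∃ (X₂ : ModuleCat.{0} R) (d : X₂ ⟶ X₁) (w : d ≫ f = 0), Projective X₂ ∧
      (ShortComplex.mk d f w).Exact ∧ (Module.Finite R X₁ → Module.Finite R X₂) := by
  obtain ⟨P, p, h1, h2, h3⟩ := exists_cover (ModuleCat.of R (LinearMap.ker f.hom))
  refine ⟨P, p ≫ ModuleCat.ofHom (LinearMap.ker f.hom).subtype, ?_, h1, ?_, ?_⟩
  · ext x
    exact (p.hom x).2
  · rw [ShortComplex.moduleCat_exact_iff]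
    intro x hx
    obtain ⟨y, hy⟩ := (ModuleCat.epi_iff_surjective p).1 h2 ⟨x, hx⟩
    exact ⟨y, congrArg Subtype.val hy⟩
  · intro h
    apply h3
    change Module.Finite R (LinearMap.ker f.hom)
    infer_instance

def succ {X₀ X₁ : ModuleCat.{0} R} (f : X₁ ⟶ X₀) :
    Σ' (X₂ : ModuleCat.{0} R) (d : X₂ ⟶ X₁), d ≫ f = 0 :=
  ⟨(exists_d f).choose, (exists_d f).choose_spec.choose, (exists_d f).choose_spec.choose_spec.choose⟩

lemma succ_proj {X₀ X₁ : ModuleCat.{0} R} (f : X₁ ⟶ X₀) : Projective (succ f).1 :=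
  (exists_d f).choose_spec.choose_spec.choose_spec.1
lemma succ_exact {X₀ X₁ : ModuleCat.{0} R} (f : X₁ ⟶ X₀) :
    (ShortComplex.mk (succ f).2.1 f (succ f).2.2).Exact :=
  (exists_d f).choose_spec.choose_spec.choose_spec.2.1
lemma succ_finite {X₀ X₁ : ModuleCat.{0} R} (f : X₁ ⟶ X₀) (h : Module.Finite R X₁) :
    Module.Finite R (succ f).1 :=
  (exists_d f).choose_spec.choose_spec.choose_spec.2.2 h

variable {X₀ Z : ModuleCat.{0} R} (p : X₀ ⟶ Z)

def cplx : ChainComplex (ModuleCat.{0} R) ℕ :=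
  ChainComplex.mk' X₀ (succ p).1 (succ p).2.1 (fun f => succ f)

lemma cplx_d_1_0 : (cplx p).d 1 0 = (succ p).2.1 := by
  simp [cplx]

lemma cplx_exactAt_succ (n : ℕ) : (cplx p).ExactAt (n + 1) := by
  rw [HomologicalComplex.exactAt_iff' _ (n + 1 + 1) (n + 1) n (by simp) (by simp)]
  let e := ChainComplex.mk'XIso X₀ (succ p).1 (succ p).2.1 (fun f => succ f) n
  refine (ShortComplex.exact_iff_of_iso ?_).2 (succ_exact ((cplx p).d (n + 1) n))
  refine ShortComplex.isoMk e (Iso.refl _) (Iso.refl _) ?_ ?_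
  · have := ChainComplex.mk'_d X₀ (succ p).1 (succ p).2.1 (fun f => succ f) n
    simp only [Iso.refl_hom]
    exact this.symm
  · exact (Category.id_comp _).trans (Category.comp_id _).symm

lemma cplx_proj [Projective X₀] (n : ℕ) : Projective ((cplx p).X n) := by
  obtain (_ | _ | n) := n
  · assumption
  · exact succ_proj p
  · exact Projective.of_iso (ChainComplex.mk'XIso X₀ (succ p).1 (succ p).2.1 (fun f => succ f) n).symm
      (succ_proj _)

lemma cplx_finite (h : Module.Finite R X₀) (n : ℕ) : Module.Finite R ((cplx p).X n) := by
  induction n with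
  | zero => exact h
  | succ n ih =>
    cases n with
    | zero => exact succ_finite p h
    | succ n =>
      have := succ_finite ((cplx p).d (n + 1) n) ih
      exact @Module.Finite.equiv _ _ _ _ _ _ _ _ this
        (ChainComplex.mk'XIso X₀ (succ p).1 (succ p).2.1 (fun f => succ f) n).symm.toLinearEquiv

def piZero : cplx p ⟶ (ChainComplex.single₀ (ModuleCat.{0} R)).obj Z :=
  (ChainComplex.toSingle₀Equiv _ _).symm ⟨p, by rw [cplx_d_1_0]; exact (succ p).2.2⟩

lemma piZero_f : (piZero p).f 0 = p :=
  ChainComplex.toSingle₀Equiv_symm_apply_f_zero _ _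

def res [Projective X₀] [Epi p] : ProjectiveResolution Z where
  complex := cplx p
  projective := cplx_proj p
  π := piZero p
  quasiIso := ⟨fun n => by
    cases n
    · rw [ChainComplex.quasiIsoAt₀_iff, ShortComplex.quasiIso_iff_of_zeros']
      · refine (ShortComplex.exact_and_epi_g_iff_of_iso ?_).2
          ⟨succ_exact p, by dsimp; infer_instance⟩
        exact ShortComplex.isoMk (Iso.refl _) (Iso.refl _) (Iso.refl _)
          ((Category.id_comp _).trans ((cplx_d_1_0 p).symm.trans (Category.comp_id _).symm))
          ((Category.id_comp _).trans (Eq.trans (piZero_f p).symm (Category.comp_id _).symm))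
      all_goals rfl
    · rw [quasiIsoAt_iff_exactAt']
      · apply cplx_exactAt_succ
      · apply ChainComplex.exactAt_succ_single_obj⟩

lemma hasFGProjRes_of_finite (M : ModuleCat.{0} R) [Module.Finite R M] : HasFGProjRes R M := by
  obtain ⟨P, p, _, _, h⟩ := exists_cover M
  exact ⟨res p, fun i => cplx_finite p (h inferInstance) i⟩

lemma finite_of_hasFGProjRes (M : ModuleCat.{0} R) (h : HasFGProjRes R M) : Module.Finite R M := by
  obtain ⟨P, hP⟩ := h
  have h0 : Epi (P.π.f 0) := inferInstance
  have := hP 0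
  exact Module.Finite.of_surjective (P.π.f 0).hom ((ModuleCat.epi_iff_surjective _).1 h0)

end FGRes

open RingTheory.Sequence Abelian

lemma krull_quot {R : Type} [CommRing R] (rs : List R) (h : IsWeaklyRegular R rs) :
    ringKrullDim (R ⧸ Ideal.ofList rs) + rs.length ≤ ringKrullDim R := by
  induction rs using List.reverseRecOn with
  | nil => simpa using ringKrullDim_quotient_le _
  | append_singleton rs r ih =>
    rw [isWeaklyRegular_append_iff, isWeaklyRegular_singleton_iff] at h
    obtain ⟨h1, h2⟩ := h
    have e : Ideal.ofList rs • (⊤ : Submodule R R) = Ideal.ofList rs := by simp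
    rw [e] at h2
    have h3 : Ideal.Quotient.mk (Ideal.ofList rs) r ∈ nonZeroDivisors (R ⧸ Ideal.ofList rs) := by
      rw [mem_nonZeroDivisors_iff_right]
      intro x hx
      apply h2
      simp only [smul_zero]
      rw [Algebra.smul_def, mul_comm]
      exact hx
    have h4 := ringKrullDim_quotient_succ_le_of_nonZeroDivisor h3
    have e2 := ringKrullDim_eq_of_ringEquiv
      (DoubleQuot.quotQuotEquivQuotSup (Ideal.ofList rs) (Ideal.span {r}))
    rw [Ideal.map_span, Set.image_singleton] at e2
    rw [Ideal.ofList_append, Ideal.ofList_singleton, ← e2]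
    refine le_trans ?_ (ih h1)
    refine le_trans (le_of_eq ?_) (add_le_add_left h4 _)
    simp [add_assoc, add_comm]

lemma artinian_of_krull {R : Type} [CommRing R] [IsNoetherianRing R] (M : Type) [AddCommGroup M]
    [Module R M] [Module.Finite R M] (h : ringKrullDim (R ⧸ Module.annihilator R M) ≤ 0) :
    IsFiniteLength R M := by
  have : IsArtinianRing (R ⧸ Module.annihilator R M) :=
    isArtinianRing_iff_isNoetherianRing_krullDimLE_zero.2
      ⟨inferInstance, Ring.krullDimLE_iff.2 (by simpa using h)⟩
  rw [isFiniteLength_iff_isNoetherian_isArtinian]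
  refine ⟨inferInstance, ?_⟩
  let := Module.quotientAnnihilator (R := R) (M := M)
  have : IsScalarTower R (R ⧸ Module.annihilator R M) M := inferInstance
  have : Module.Finite (R ⧸ Module.annihilator R M) M := Module.Finite.of_restrictScalars_finite R _ _
  have : IsArtinian (R ⧸ Module.annihilator R M) M := inferInstance
  have hs : Function.Surjective (Ideal.Quotient.mk (Module.annihilator R M)) :=
    Ideal.Quotient.mk_surjective
  exact isArtinian_of_surjective_algebraMap (R := R ⧸ Module.annihilator R M) hs

open MvPolynomial in
lemma weaklyRegular_X {K : Type} [Field K] {n : ℕ} (a : Fin n → K) :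
    IsWeaklyRegular (MvPolynomial (Fin n) K) (List.ofFn fun i => (X i - C (a i) : MvPolynomial (Fin n) K)) := by
  rw [isWeaklyRegular_iff_Fin]
  rintro ⟨i, hi⟩
  rw [List.length_ofFn] at hi
  set I := Ideal.ofList (List.take i (List.ofFn fun i => (X i - C (a i) : MvPolynomial (Fin n) K))) with hI
  have e : I • (⊤ : Submodule (MvPolynomial (Fin n) K) (MvPolynomial (Fin n) K)) = I := by simp
  have hmem : ∀ j : Fin n, j.1 < i → X j - C (a j) ∈ I := by
    intro j hj
    apply Ideal.subset_span
    simp only [Set.mem_ofPred_eq]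
    rw [List.mem_take_iff_getElem]
    exact ⟨j, by simp [hj], by simp⟩
  let φ : MvPolynomial (Fin n) K →ₐ[K] MvPolynomial (Fin n) K :=
    aeval fun j => if j.1 < i then C (a j) else X j
  have hle : ∀ f ∈ I, φ f = 0 := by
    suffices I ≤ RingHom.ker φ from fun f hf => this hf
    apply Ideal.span_le.2
    intro f hf
    simp only [Set.mem_ofPred_eq] at hf
    rw [List.mem_take_iff_getElem] at hf
    obtain ⟨j, hj, rfl⟩ := hf
    have : j < i := by simp at hj; omega
    simp [φ, this, RingHom.mem_ker, algHom_C]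
  have hge : ∀ f, φ f = 0 → f ∈ I := by
    have : (Ideal.Quotient.mkₐ K I).comp φ = Ideal.Quotient.mkₐ K I := by
      apply MvPolynomial.algHom_ext
      intro j
      by_cases hj : j.1 < i
      · simp only [AlgHom.comp_apply, φ, aeval_X, hj, if_true]
        exact (Ideal.Quotient.eq.2 (hmem j hj)).symm
      · simp [φ, hj]
    intro f hf
    have := DFunLike.congr_fun this f
    rw [AlgHom.comp_apply, hf, map_zero] at this
    exact Ideal.Quotient.eq_zero_iff_mem.1 this.symm
  rw [e]
  have hget : (List.ofFn fun i => (X i - C (a i) : MvPolynomial (Fin n) K))[(⟨i, by simpa using hi⟩ : Fin (List.ofFn fun i => (X i - C (a i) : MvPolynomial (Fin n) K)).length)] = X ⟨i, hi⟩ - C (a ⟨i, hi⟩) := by simp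
  rw [hget, isSMulRegular_iff_right_eq_zero_of_smul]
  intro x hx
  obtain ⟨f, rfl⟩ := Ideal.Quotient.mk_surjective x
  have hx' : Ideal.Quotient.mk I ((X ⟨i, hi⟩ - C (a ⟨i, hi⟩)) * f) = 0 := by
    exact hx
  have h1 := hle _ (Ideal.Quotient.eq_zero_iff_mem.1 hx')
  rw [map_mul] at h1
  have h2 : φ (X ⟨i, hi⟩ - C (a ⟨i, hi⟩)) ≠ 0 := by
    intro h0
    have := congrArg (eval fun _ => a ⟨i,hi⟩ + 1) h0
    simp [φ, algHom_C] at this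
  exact Ideal.Quotient.eq_zero_iff_mem.2 (hge _ ((mul_eq_zero.1 h1).resolve_left h2))

open MvPolynomial in
lemma ofList_X {K : Type} [Field K] {n : ℕ} (a : Fin n → K) :
    Ideal.ofList (List.ofFn fun i => (X i - C (a i) : MvPolynomial (Fin n) K)) =
      vanishingIdeal K {a} := by
  apply le_antisymm
  · apply Ideal.span_le.2
    intro f hf
    simp only [Set.mem_ofPred_eq, List.mem_ofFn] at hf
    obtain ⟨j, rfl⟩ := hf
    rw [SetLike.mem_coe, mem_vanishingIdeal_singleton_iff]
    simp
  · intro f hf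
    rw [mem_vanishingIdeal_singleton_iff] at hf
    set I := Ideal.ofList (List.ofFn fun i => (X i - C (a i) : MvPolynomial (Fin n) K)) 
    have : ((Algebra.ofId K _).comp (aeval a)) = Ideal.Quotient.mkₐ K I := by
      apply MvPolynomial.algHom_ext
      intro j
      simp only [AlgHom.comp_apply, aeval_X]
      refine (Ideal.Quotient.eq (I := I).2 (Ideal.subset_span ?_)).symm
      simp [List.mem_ofFn]
    have := DFunLike.congr_fun this f
    rw [AlgHom.comp_apply, hf, map_zero] at this
    exact Ideal.Quotient.eq_zero_iff_mem.1 this.symm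

/-- A weakly regular sequence raises the projective dimension by at most its length. -/
lemma pd_quot {R : Type} [CommRing R] (M : ModuleCat.{0} R) (k : ℕ)
    (hM : HasProjectiveDimensionLT M k) (rs : List R) (h : IsWeaklyRegular M rs) :
    HasProjectiveDimensionLT (ModuleCat.of R (M ⧸ Ideal.ofList rs • (⊤ : Submodule R M)))
      (k + rs.length) := by
  induction rs generalizing M k with
  | nil =>
    have e : Ideal.ofList ([] : List R) • (⊤ : Submodule R M) = ⊥ := by simp
    exact hasProjectiveDimensionLT_of_iso
      (Submodule.quotEquivOfEqBot _ e).symm.toModuleIso k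
  | cons r rs ih =>
    rw [isWeaklyRegular_cons_iff] at h
    have hS := h.1.smulShortComplex_shortExact
    have h1 : HasProjectiveDimensionLT (ModuleCat.of R (QuotSMulTop r M)) (k + 1) :=
      hS.hasProjectiveDimensionLT_X₃ k hM
        (hasProjectiveDimensionLT_of_ge M k (k + 1) (Nat.le_succ _))
    have h2 := ih (ModuleCat.of R (QuotSMulTop r M)) (k + 1) h1 h.2
    rw [List.length_cons, Nat.add_comm rs.length 1, ← Nat.add_assoc]
    exact @hasProjectiveDimensionLT_of_iso _ _ _ _ _
      (Submodule.quotOfListConsSMulTopEquivQuotSMulTopInner M r rs).symm.toModuleIso _ h2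

/-- `Ext` vanishing against the ring below degree `n`, together with `pd ≤ n`. -/
def Good (R : Type) [CommRing R] (n : ℕ) (M : ModuleCat.{0} R) : Prop :=
  HasProjectiveDimensionLT M (n + 1) ∧
    ∀ i < n, Subsingleton (Ext.{0} M (ModuleCat.of R R) i)

lemma Good.of_shortExact {R : Type} [CommRing R] {n : ℕ} {S : ShortComplex (ModuleCat.{0} R)}
    (hS : S.ShortExact) (h1 : Good R n S.X₁) (h3 : Good R n S.X₃) : Good R n S.X₂ := by
  refine ⟨hS.hasProjectiveDimensionLT_X₂ _ h1.1 h3.1, fun i hi => ?_⟩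
  have z1 := AddCommGrpCat.isZero_of_iff_subsingleton.mpr (h1.2 i hi)
  have z3 := AddCommGrpCat.isZero_of_iff_subsingleton.mpr (h3.2 i hi)
  exact AddCommGrpCat.subsingleton_of_isZero <| ShortComplex.Exact.isZero_of_both_zeros
    (Ext.contravariant_sequence_exact₂' hS (ModuleCat.of R R) i)
    (z3.eq_zero_of_src _) (z1.eq_zero_of_tgt _)

lemma Good.of_iso {R : Type} [CommRing R] {n : ℕ} {M N : ModuleCat.{0} R} (e : M ≅ N)
    (h : Good R n M) : Good R n N := by
  have := h.1
  refine ⟨hasProjectiveDimensionLT_of_iso e _, fun i hi => ?_⟩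
  have := h.2 i hi
  refine ⟨fun x y => ?_⟩
  have key : ∀ x : Ext.{0} N (ModuleCat.of R R) i, x = 0 := by
    intro x
    have h0 : (Ext.mk₀ e.hom).comp x (zero_add i) = 0 := Subsingleton.elim _ _
    have h1 := congrArg (fun y => (Ext.mk₀ e.inv).comp y (zero_add i)) h0
    simpa using h1
  rw [key x, key y]

lemma good_quot_maximal {K : Type} [Field K] [IsAlgClosed K] {n : ℕ}
    (I : Ideal (MvPolynomial (Fin n) K)) (hI : I.IsMaximal) :
    Good (MvPolynomial (Fin n) K) n (ModuleCat.of _ (MvPolynomial (Fin n) K ⧸ I)) := by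
  obtain ⟨a, rfl⟩ := MvPolynomial.isMaximal_iff_eq_vanishingIdeal_singleton.1 hI
  have hreg := weaklyRegular_X a
  have hof := ofList_X a
  set rs := List.ofFn fun i => (MvPolynomial.X i - MvPolynomial.C (a i) : MvPolynomial (Fin n) K)
  have hlen : rs.length = n := by simp [rs]
  rw [← hof] at hI ⊢
  have e : Ideal.ofList rs • (⊤ : Submodule (MvPolynomial (Fin n) K) (MvPolynomial (Fin n) K)) =
    Ideal.ofList rs := by simp
  constructor
  · have := pd_quot (ModuleCat.of (MvPolynomial (Fin n) K) (MvPolynomial (Fin n) K)) 1 inferInstance rs hreg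
    rw [hlen, Nat.add_comm] at this
    exact @hasProjectiveDimensionLT_of_iso _ _ _ _ _
      (LinearEquiv.toModuleIso (R := MvPolynomial (Fin n) K) (Submodule.quotEquivOfEq _ _ e)) _ this
  · have hlt : Ideal.ofList rs • (⊤ : Submodule (MvPolynomial (Fin n) K)
        (ModuleCat.of (MvPolynomial (Fin n) K) (MvPolynomial (Fin n) K))) < ⊤ := by
      change Ideal.ofList rs • (⊤ : Submodule (MvPolynomial (Fin n) K) (MvPolynomial (Fin n) K)) < ⊤
      rw [e]
      exact lt_top_iff_ne_top.2 hI.ne_top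
    have := ModuleCat.subsingleton_ext_of_exists_isRegular (Ideal.ofList rs)
      (ModuleCat.of _ (MvPolynomial (Fin n) K ⧸ Ideal.ofList rs))
      (by
        rw [Module.support_eq_zeroLocus]
        change PrimeSpectrum.zeroLocus
          (Module.annihilator (MvPolynomial (Fin n) K)
            (MvPolynomial (Fin n) K ⧸ Ideal.ofList rs) : Set (MvPolynomial (Fin n) K)) ⊆ _
        rw [Ideal.annihilator_quotient])
      (ModuleCat.of (MvPolynomial (Fin n) K) (MvPolynomial (Fin n) K)) hlt rs
      (fun r hr => Ideal.subset_span hr) ⟨hreg, hlt.ne'⟩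
    rwa [hlen] at this

lemma good_of_finiteLength {K : Type} [Field K] [IsAlgClosed K] {n : ℕ}
    (M : Type) [AddCommGroup M] [Module (MvPolynomial (Fin n) K) M]
    (h : IsFiniteLength (MvPolynomial (Fin n) K) M) :
    Good (MvPolynomial (Fin n) K) n (ModuleCat.of _ M) := by
  induction h with
  | @of_subsingleton M _ _ _ =>
    have hz : Limits.IsZero (ModuleCat.of (MvPolynomial (Fin n) K) M) :=
      ModuleCat.isZero_of_subsingleton _
    have h0 := hz.hasProjectiveDimensionLT_zero
    exact ⟨hasProjectiveDimensionLT_of_ge _ 0 _ (Nat.zero_le _), fun i _ =>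
      HasProjectiveDimensionLT.subsingleton _ 0 i (Nat.zero_le _) _⟩
  | @of_simple_quotient M _ _ N hs _ ih =>
    obtain ⟨I, hI, ⟨e⟩⟩ := isSimpleModule_iff_quot_maximal.1 hs
    have h3 : Good (MvPolynomial (Fin n) K) n (ModuleCat.of _ (M ⧸ N)) :=
      (good_quot_maximal I hI).of_iso e.symm.toModuleIso
    have hS := LinearMap.shortExact_shortComplexKer (N.mkQ_surjective)
    refine Good.of_shortExact hS ?_ h3
    refine ih.of_iso (LinearEquiv.toModuleIso (LinearEquiv.ofEq _ _ ?_))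
    simp

lemma krull_poly (K : Type) [Field K] (n : ℕ) : ringKrullDim (MvPolynomial (Fin n) K) = n := by
  rw [MvPolynomial.ringKrullDim_of_isNoetherianRing]
  simp

/-- A nonzero finite module with no `Ext` into the ring below degree `k` yields a regular
sequence of length `k` in its annihilator, so the dimension drops by `k`. -/
lemma krull_ann {K : Type} [Field K] {n : ℕ} (k : ℕ) (M : ModuleCat.{0} (MvPolynomial (Fin n) K))
    [Module.Finite (MvPolynomial (Fin n) K) M] [Nontrivial M]
    (h : ∀ i < k, Subsingleton (Ext.{0} M (ModuleCat.of (MvPolynomial (Fin n) K) (MvPolynomial (Fin n) K)) i)) :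
    ringKrullDim (MvPolynomial (Fin n) K ⧸ Module.annihilator (MvPolynomial (Fin n) K) M) + k
      ≤ n := by
  set I := Module.annihilator (MvPolynomial (Fin n) K) M
  have hI : I ≠ ⊤ := by
    intro h
    have := Module.annihilator_eq_top_iff.1 h
    exact not_subsingleton M this
  obtain ⟨rs, hlen, hmem, hreg⟩ := ModuleCat.exists_isRegular_of_exists_subsingleton_ext I k
    (ModuleCat.of (MvPolynomial (Fin n) K) (MvPolynomial (Fin n) K)) (by
      change I • (⊤ : Submodule (MvPolynomial (Fin n) K) (MvPolynomial (Fin n) K)) < ⊤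
      simpa using lt_top_iff_ne_top.2 hI) M Module.support_eq_zeroLocus h
  have h1 := krull_quot rs hreg.1
  rw [krull_poly, hlen] at h1
  have hle : Ideal.ofList rs ≤ I := Ideal.span_le.2 hmem
  refine le_trans (add_le_add_left ?_ _) h1
  exact ringKrullDim_le_of_surjective _ (Ideal.Quotient.factor_surjective hle)

/-- for `Λ = K[x_1,…,x_n]` over an algebraically closed field `K`, the
category `H^n_Λ` is exactly the category of (nonzero) `Λ`-modules of finite length. -/
theorem polynomial_Hn_is_finite_length (K : Type) [Field K] [IsAlgClosed K] (n : ℕ)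
    (hn : 0 < n) (M : ModuleCat.{0} (MvPolynomial (Fin n) K)) :
    MemH (MvPolynomial (Fin n) K) n M ↔
      (IsFiniteLength (MvPolynomial (Fin n) K) ↥M ∧ Nontrivial ↥M) := by
  constructor
  · intro h
    have hfin := FGRes.finite_of_hasFGProjRes M h.fg_res
    have hnt : Nontrivial M := by
      by_contra hM
      rw [not_nontrivial_iff_subsingleton] at hM
      obtain ⟨N, hN⟩ := h.pd_ge
      have hz : Limits.IsZero M := ModuleCat.isZero_of_subsingleton _
      have h0 := hz.hasProjectiveDimensionLT_zero
      have := HasProjectiveDimensionLT.subsingleton M 0 n (Nat.zero_le _) N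
      exact not_subsingleton _ this
    refine ⟨?_, hnt⟩
    have hk := krull_ann n M fun i hi => (h.gorenstein i hi.ne)
    apply artinian_of_krull
    refine (ENat.WithBot.add_le_add_natCast_right_iff (c := n)).1 (hk.trans ?_)
    rw [zero_add]
  · rintro ⟨hfl, hnt⟩
    have hg : Good _ n M := good_of_finiteLength M hfl
    have hpd := hg.1
    have := (isFiniteLength_iff_isNoetherian_isArtinian.1 hfl).1
    have hfin : Module.Finite (MvPolynomial (Fin n) K) M := inferInstance
    refine ⟨fun N i hi => HasProjectiveDimensionLT.subsingleton M (n + 1) i hi N,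
      ⟨ModuleCat.of _ (MvPolynomial (Fin n) K), ?_⟩, FGRes.hasFGProjRes_of_finite M, fun i hi => ?_⟩
    · by_contra hc
      rw [not_nontrivial_iff_subsingleton] at hc
      have hk := krull_ann (n + 1) M fun i hi => by
        rcases Nat.lt_succ_iff_lt_or_eq.1 hi with h | rfl
        · exact hg.2 i h
        · exact hc
      have hI : Nontrivial
          (MvPolynomial (Fin n) K ⧸ Module.annihilator (MvPolynomial (Fin n) K) M) := by
        rw [Ideal.Quotient.nontrivial_iff]
        intro h
        exact not_subsingleton M (Module.annihilator_eq_top_iff.1 h)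
      have h0 := ringKrullDim_nonneg_of_nontrivial
        (R := MvPolynomial (Fin n) K ⧸ Module.annihilator (MvPolynomial (Fin n) K) M)
      have h1 := le_trans (add_le_add_left h0 _) hk
      rw [zero_add] at h1
      have h2 : n + 1 ≤ n := by exact_mod_cast h1
      omega
    · rcases lt_or_gt_of_ne hi with h | h
      · exact (hg.2 i h)
      · exact HasProjectiveDimensionLT.subsingleton M (n + 1) i h _

end
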